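/- There are absolute constants a and A such that for every integer k ≥ 2 there exists an integer d ≤ a·k²·log k with the following property: for every k-Fourier-sparse signal g, every t ∈ ℝ, and every θ > 0, |g(t)|² ≤ A·k·∑_{j=1}^{d} |g(t + j·θ)|². -/

import Mathlib

open Real

open Matrix in
/-- The Gram matrix `∑_{j < n} x_j x_jᴴ` of the first `n` vectors of a sequence. -/
noncomputable def partialGram {ι : Type*} (x : ℕ → ι → ℂ) (n : ℕ) : Matrix ι ι ℂ :=
  ∑ j ∈ Finset.range n, vecMulVec (x j) (star (x j))

open Matrix in
/-- If the first `n` vectors have a nonsingular Gram matrix, the next one is a combination of them,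
and the squared `ℓ²`-norm of the coefficients is the relative growth of the Gram determinant. -/
theorem exists_coeff_det_partialGram_succ {ι : Type*} [Fintype ι] [DecidableEq ι]
    (x : ℕ → ι → ℂ) (n : ℕ) (hn : IsUnit (partialGram x n).det) :
    ∃ w : ℕ → ℂ, x n = ∑ j ∈ Finset.range n, w j • x j ∧
      (partialGram x (n + 1)).det =
        (partialGram x n).det * ((1 + ∑ j ∈ Finset.range n, ‖w j‖ ^ 2 : ℝ) : ℂ) := by
  set y : ι → ℂ := (partialGram x n)⁻¹ *ᵥ x n with hy
  have hx : x n = ∑ j ∈ Finset.range n, (star (x j) ⬝ᵥ y) • x j := by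
    have h : partialGram x n *ᵥ y = x n := by
      rw [hy, mulVec_mulVec, mul_nonsing_inv _ hn, one_mulVec]
    conv_lhs => rw [← h]
    simp [partialGram, sum_mulVec, vecMulVec_mulVec]
  refine ⟨fun j => star (x j) ⬝ᵥ y, hx, ?_⟩
  have hstar : star (x n) ⬝ᵥ y = ((∑ j ∈ Finset.range n, ‖star (x j) ⬝ᵥ y‖ ^ 2 : ℝ) : ℂ) := by
    conv_lhs => rw [hx]
    rw [star_sum, sum_dotProduct, Complex.ofReal_sum]
    refine Finset.sum_congr rfl fun j _ => ?_
    rw [star_smul, smul_dotProduct, smul_eq_mul, Complex.star_def, mul_comm, Complex.mul_conj,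
      Complex.normSq_eq_norm_sq]
  have hsucc : partialGram x (n + 1) = partialGram x n + vecMulVec (x n) (star (x n)) :=
    Finset.sum_range_succ _ _
  rw [hsucc, vecMulVec_eq Unit, det_add_replicateCol_mul_replicateRow hn, det_unique (n := Unit),
    Complex.ofReal_add, Complex.ofReal_one, ← hstar, hy, dotProduct_mulVec]
  simp [Matrix.mul_apply, dotProduct, vecMul]

/-- If the Gram determinant is at least one at time `k` and smaller than `2 ^ (d - k)` at time `d`,
then some vector in between is a combination of the previous ones with small coefficients. -/
theorem exists_small_coeff_of_det_partialGram_lt {ι : Type*} [Fintype ι] [DecidableEq ι]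
    (x : ℕ → ι → ℂ) {k d : ℕ} (hkd : k ≤ d) (hk : 1 ≤ ‖(partialGram x k).det‖)
    (hd : ‖(partialGram x d).det‖ < 2 ^ (d - k)) :
    ∃ n < d, ∃ w : ℕ → ℂ, x n = ∑ j ∈ Finset.range n, w j • x j ∧
      ∑ j ∈ Finset.range n, ‖w j‖ ^ 2 ≤ 1 := by
  by_contra! hcon
  have key : ∀ m, k + m ≤ d → 2 ^ m ≤ ‖(partialGram x (k + m)).det‖ := by
    intro m
    induction m with
    | zero => exact fun _ => by simpa using hk
    | succ m ih =>
      intro hm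
      have ihm := ih (by omega)
      have hpos : 0 < ‖(partialGram x (k + m)).det‖ := lt_of_lt_of_le (by positivity) ihm
      obtain ⟨w, hw, hdet⟩ := exists_coeff_det_partialGram_succ x (k + m)
        (isUnit_iff_ne_zero.2 (norm_pos_iff.1 hpos))
      have hbig := hcon (k + m) (by omega) w hw
      rw [← add_assoc, hdet, norm_mul, Complex.norm_real, Real.norm_of_nonneg (by positivity),
        pow_succ]
      exact mul_le_mul ihm (by linarith) (by norm_num) hpos.le
  have := key (d - k) (by omega)
  rw [Nat.add_sub_cancel' hkd] at this
  linarith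

/-- The coefficient of `∏_{m < l} (X - z m)` in the Newton expansion of `X ^ j`. -/
def newtonCoeff (z : ℕ → ℂ) : ℕ → ℕ → ℂ
  | 0, 0 => 1
  | 0, _ + 1 => 0
  | j + 1, 0 => z 0 * newtonCoeff z j 0
  | j + 1, l + 1 => z (l + 1) * newtonCoeff z j (l + 1) + newtonCoeff z j l

theorem newtonCoeff_eq_zero (z : ℕ → ℂ) : ∀ {j l : ℕ}, j < l → newtonCoeff z j l = 0
  | 0, _ + 1, _ => by simp [newtonCoeff]
  | j + 1, l + 1, h => by
    rw [newtonCoeff, newtonCoeff_eq_zero z (by omega : j < l + 1),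
      newtonCoeff_eq_zero z (by omega : j < l), mul_zero, zero_add]

theorem newtonCoeff_self (z : ℕ → ℂ) : ∀ j : ℕ, newtonCoeff z j j = 1
  | 0 => by simp [newtonCoeff]
  | j + 1 => by
    rw [newtonCoeff, newtonCoeff_eq_zero z (by omega : j < j + 1), newtonCoeff_self z j, mul_zero,
      zero_add]

theorem norm_newtonCoeff_le {z : ℕ → ℂ} (hz : ∀ i, ‖z i‖ ≤ 1) :
    ∀ j l : ℕ, ‖newtonCoeff z j l‖ ≤ j.choose l
  | 0, 0 => by simp [newtonCoeff]
  | 0, _ + 1 => by simp [newtonCoeff]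
  | j + 1, 0 => by
    have h := norm_newtonCoeff_le hz j 0
    rw [newtonCoeff, norm_mul]
    simp only [Nat.choose_zero_right, Nat.cast_one] at h ⊢
    exact mul_le_one₀ (hz 0) (norm_nonneg _) h
  | j + 1, l + 1 => by
    rw [newtonCoeff, Nat.choose_succ_succ, Nat.cast_add, add_comm (j.choose l : ℝ)]
    refine norm_add_le_of_le ?_ (norm_newtonCoeff_le hz j l)
    rw [norm_mul]
    exact (mul_le_of_le_one_left (norm_nonneg _) (hz _)).trans (norm_newtonCoeff_le hz j (l + 1))

theorem pow_eq_sum_newtonCoeff (z : ℕ → ℂ) {k i : ℕ} (hi : i < k) (j : ℕ) :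
    z i ^ j = ∑ l ∈ Finset.range k,
      newtonCoeff z j l * ∏ m ∈ Finset.range l, (z i - z m) := by
  obtain ⟨k, rfl⟩ : ∃ k', k = k' + 1 := ⟨k - 1, by omega⟩
  induction j with
  | zero => simp [Finset.sum_range_succ', newtonCoeff]
  | succ j ih =>
    have hroot : ∏ m ∈ Finset.range (k + 1), (z i - z m) = 0 :=
      Finset.prod_eq_zero (Finset.mem_range.2 hi) (sub_self _)
    have hsplit : ∀ l, z i * (newtonCoeff z j l * ∏ m ∈ Finset.range l, (z i - z m)) =
        z l * newtonCoeff z j l * ∏ m ∈ Finset.range l, (z i - z m) +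
          newtonCoeff z j l * ∏ m ∈ Finset.range (l + 1), (z i - z m) := by
      intro l
      rw [Finset.prod_range_succ]
      ring
    rw [pow_succ', ih, Finset.mul_sum, Finset.sum_congr rfl fun l _ => hsplit l,
      Finset.sum_add_distrib, Finset.sum_range_succ' _ k,
      Finset.sum_range_succ (fun l => newtonCoeff z j l * _) k, hroot, Finset.sum_range_succ' _ k]
    simp only [newtonCoeff, add_mul, Finset.sum_add_distrib]
    ring

open Matrix in
theorem det_partialGram_newtonCoeff (z : ℕ → ℂ) (k : ℕ) :
    (partialGram (fun j (l : Fin k) => newtonCoeff z j l) k).det = 1 := by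
  let X : Matrix (Fin k) (Fin k) ℂ := of fun l j => newtonCoeff z j l
  have hG : partialGram (fun j (l : Fin k) => newtonCoeff z j l) k = X * Xᴴ := by
    ext a b
    rw [Matrix.mul_apply]
    simp [partialGram, Matrix.sum_apply, vecMulVec_apply, conjTranspose_apply, X, Finset.sum_range]
  have hdet : X.det = 1 := by
    rw [det_of_isUpperTriangular]
    · simp [X, newtonCoeff_self]
    · intro a b hab
      exact newtonCoeff_eq_zero z hab
  rw [hG, det_mul, det_conjTranspose, hdet]
  simp

open Matrix in
theorem norm_det_partialGram_newtonCoeff_le {z : ℕ → ℂ} (hz : ∀ i, ‖z i‖ ≤ 1) {k d : ℕ}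
    (hkd : k ≤ d) :
    ‖(partialGram (fun j (l : Fin k) => newtonCoeff z j l) d).det‖ ≤ (d : ℝ) ^ (2 * k ^ 2) := by
  rcases Nat.eq_zero_or_pos k with rfl | hk
  · simp
  have hd : (1 : ℝ) ≤ d := by exact_mod_cast hk.trans_le hkd
  have hcoeff : ∀ j ∈ Finset.range d, ∀ l : Fin k, ‖newtonCoeff z j l‖ ≤ (d : ℝ) ^ (k - 1) := by
    intro j hj l
    calc ‖newtonCoeff z j l‖ ≤ (j.choose l : ℝ) := norm_newtonCoeff_le hz j l
      _ ≤ (j : ℝ) ^ (l : ℕ) := by exact_mod_cast Nat.choose_le_pow j l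
      _ ≤ (d : ℝ) ^ (l : ℕ) := by
        gcongr
        exact (Finset.mem_range.1 hj).le
      _ ≤ (d : ℝ) ^ (k - 1) := pow_le_pow_right₀ hd (by omega)
  have hentry : ∀ a b, ‖partialGram (fun j (l : Fin k) => newtonCoeff z j l) d a b‖ ≤
      (d : ℝ) ^ (2 * k - 1) := by
    intro a b
    rw [partialGram, Matrix.sum_apply]
    calc _ ≤ ∑ j ∈ Finset.range d, (d : ℝ) ^ (k - 1) * (d : ℝ) ^ (k - 1) := by
          refine norm_sum_le_of_le _ fun j hj => ?_
          rw [vecMulVec_apply, Pi.star_apply, norm_mul, norm_star]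
          exact mul_le_mul (hcoeff j hj a) (hcoeff j hj b) (norm_nonneg _) (by positivity)
      _ = (d : ℝ) ^ (2 * k - 1) := by
          rw [Finset.sum_const, Finset.card_range, nsmul_eq_mul, ← pow_add, ← pow_succ']
          congr 1
          omega
  have hdet := det_le (abv := NormedField.toAbsoluteValue ℂ) hentry
  rw [Fintype.card_fin, nsmul_eq_mul] at hdet
  calc _ ≤ (k.factorial : ℝ) * ((d : ℝ) ^ (2 * k - 1)) ^ k := hdet
    _ ≤ (d : ℝ) ^ k * ((d : ℝ) ^ (2 * k - 1)) ^ k := by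
        gcongr
        calc (k.factorial : ℝ) ≤ (k : ℝ) ^ k := by exact_mod_cast k.factorial_le_pow
          _ ≤ (d : ℝ) ^ k := by gcongr
    _ = (d : ℝ) ^ (2 * k ^ 2) := by
        rw [← mul_pow, ← pow_succ', ← pow_mul]
        congr 1
        rw [Nat.sub_add_cancel (by omega)]
        ring

/-- Some power `z i ^ n` with `n < d` is predicted from the previous ones, simultaneously for all
`i < k`, by coefficients of `ℓ²`-norm at most one. -/
theorem exists_simultaneous_prediction {k d : ℕ} (hkd : k ≤ d) (hd : d ^ (2 * k ^ 2) < 2 ^ (d - k))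
    {z : ℕ → ℂ} (hz : ∀ i, ‖z i‖ ≤ 1) :
    ∃ n < d, ∃ w : ℕ → ℂ, ∑ j ∈ Finset.range n, ‖w j‖ ^ 2 ≤ 1 ∧
      ∀ i < k, z i ^ n = ∑ j ∈ Finset.range n, w j * z i ^ j := by
  obtain ⟨n, hn, w, hw, hw1⟩ := exists_small_coeff_of_det_partialGram_lt
    (fun j (l : Fin k) => newtonCoeff z j l) hkd (by simp [det_partialGram_newtonCoeff])
    ((norm_det_partialGram_newtonCoeff_le hz hkd).trans_lt (by exact_mod_cast hd))
  refine ⟨n, hn, w, hw1, fun i hi => ?_⟩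
  have hcoeff : ∀ l ∈ Finset.range k,
      newtonCoeff z n l = ∑ j ∈ Finset.range n, w j * newtonCoeff z j l := by
    intro l hl
    simpa using congrFun hw ⟨l, Finset.mem_range.1 hl⟩
  rw [pow_eq_sum_newtonCoeff z hi, Finset.sum_congr rfl fun l hl => by rw [hcoeff l hl]]
  simp_rw [pow_eq_sum_newtonCoeff z hi, Finset.sum_mul, Finset.mul_sum, ← mul_assoc]
  exact Finset.sum_comm

theorem norm_sum_mul_sq_le (s : Finset ℕ) (w u : ℕ → ℂ) :
    ‖∑ j ∈ s, w j * u j‖ ^ 2 ≤ (∑ j ∈ s, ‖w j‖ ^ 2) * ∑ j ∈ s, ‖u j‖ ^ 2 := by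
  refine le_trans ?_ (Finset.sum_mul_sq_le_sq_mul_sq s (fun j => ‖w j‖) fun j => ‖u j‖)
  gcongr
  exact norm_sum_le_of_le _ fun j _ => (norm_mul _ _).le

theorem norm_sq_le_sum_shifts {k d : ℕ} (hkd : k ≤ d) (hd : d ^ (2 * k ^ 2) < 2 ^ (d - k))
    (v : ℕ → ℂ) (f : ℕ → ℝ) (g : ℝ → ℂ)
    (hg : ∀ x : ℝ, g x = ∑ j ∈ Finset.range k,
      v j * Complex.exp (2 * (Real.pi : ℂ) * Complex.I * (f j : ℂ) * (x : ℂ)))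
    (t θ : ℝ) :
    ‖g t‖ ^ 2 ≤ ∑ j ∈ Finset.Icc 1 d, ‖g (t + (j : ℝ) * θ)‖ ^ 2 := by
  set z : ℕ → ℂ := fun i => Complex.exp (((-(2 * Real.pi * f i * θ) : ℝ) : ℂ) * Complex.I) with hz
  obtain ⟨n, hn, w, hw1, hw⟩ := exists_simultaneous_prediction hkd hd (z := z)
    fun i => (Complex.norm_exp_ofReal_mul_I _).le
  have hpow : ∀ j : ℕ, g (t + ((n : ℝ) - j) * θ) = ∑ i ∈ Finset.range k,
      v i * Complex.exp (2 * (Real.pi : ℂ) * Complex.I * (f i : ℂ) * ((t + n * θ : ℝ) : ℂ)) *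
        z i ^ j := by
    intro j
    rw [hg]
    refine Finset.sum_congr rfl fun i _ => ?_
    rw [hz, ← Complex.exp_nat_mul, mul_assoc (v i), ← Complex.exp_add]
    congr 2
    push_cast
    ring
  have hpred : g t = ∑ j ∈ Finset.range n, w j * g (t + ((n : ℝ) - j) * θ) := by
    have h := hpow n
    rw [sub_self, zero_mul, add_zero] at h
    rw [h, Finset.sum_congr rfl fun i hi => by rw [hw i (Finset.mem_range.1 hi)]]
    simp_rw [hpow, Finset.mul_sum]
    rw [Finset.sum_comm]
    exact Finset.sum_congr rfl fun _ _ => Finset.sum_congr rfl fun _ _ => by ring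
  calc ‖g t‖ ^ 2
      ≤ (∑ j ∈ Finset.range n, ‖w j‖ ^ 2) *
          ∑ j ∈ Finset.range n, ‖g (t + ((n : ℝ) - j) * θ)‖ ^ 2 := by
        rw [hpred]
        exact norm_sum_mul_sq_le _ _ _
    _ ≤ ∑ j ∈ Finset.range n, ‖g (t + ((n : ℝ) - j) * θ)‖ ^ 2 :=
        mul_le_of_le_one_left (by positivity) hw1
    _ = ∑ j ∈ Finset.range n, ‖g (t + ((j + 1 : ℕ) : ℝ) * θ)‖ ^ 2 := by
        rw [← Finset.sum_range_reflect]
        refine Finset.sum_congr rfl fun j hj => ?_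
        have hj' : j + 1 ≤ n := Finset.mem_range.1 hj
        rw [Nat.sub_sub, Nat.cast_sub (by omega)]
        push_cast
        ring_nf
    _ = ∑ j ∈ Finset.Icc 1 n, ‖g (t + (j : ℝ) * θ)‖ ^ 2 := by
        rw [Finset.range_eq_Ico,
          Finset.sum_Ico_add' (fun j : ℕ => ‖g (t + (j : ℝ) * θ)‖ ^ 2) 0 n 1]
        rfl
    _ ≤ ∑ j ∈ Finset.Icc 1 d, ‖g (t + (j : ℝ) * θ)‖ ^ 2 :=
        Finset.sum_le_sum_of_subset_of_nonneg (Finset.Icc_subset_Icc_right hn.le)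
          fun _ _ _ => by positivity

theorem floor_sq_mul_log_bounds {k : ℕ} (hk : 2 ≤ k) :
    k ≤ ⌊100 * (k : ℝ) ^ 2 * Real.log k⌋₊ ∧
      ⌊100 * (k : ℝ) ^ 2 * Real.log k⌋₊ ^ (2 * k ^ 2) <
        2 ^ (⌊100 * (k : ℝ) ^ 2 * Real.log k⌋₊ - k) := by
  set d : ℕ := ⌊100 * (k : ℝ) ^ 2 * Real.log k⌋₊ with hd_def
  have hk2 : (2 : ℝ) ≤ k := by exact_mod_cast hk
  have hlog2 : (0.69 : ℝ) < Real.log 2 := by linarith [Real.log_two_gt_d9]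
  have hlog : Real.log 2 ≤ Real.log k := Real.log_le_log (by norm_num) hk2
  set X : ℝ := (k : ℝ) ^ 2 * Real.log k with hX
  have hkX : (k : ℝ) ≤ X := by nlinarith [mul_nonneg (sq_nonneg (k : ℝ)) (sub_nonneg.2 hlog)]
  have hle : (d : ℝ) ≤ 100 * X := by
    rw [hX, ← mul_assoc]
    exact Nat.floor_le (by positivity)
  have hge : 99 * X ≤ d := by
    have h := Nat.lt_floor_add_one (100 * (k : ℝ) ^ 2 * Real.log k)
    rw [← hd_def, mul_assoc] at h
    linarith
  have hkd : k ≤ d := by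
    have : (k : ℝ) ≤ d := by linarith
    exact_mod_cast this
  have hd0 : (0 : ℝ) < d := by linarith
  refine ⟨hkd, ?_⟩
  have hdk : (d : ℝ) ≤ (k : ℝ) ^ 10 := by
    have h1 : X ≤ (k : ℝ) ^ 3 := by
      have := Real.log_le_self (by linarith : (0 : ℝ) ≤ k)
      nlinarith [mul_le_mul_of_nonneg_left this (sq_nonneg (k : ℝ))]
    have h2 : (2 : ℝ) ^ 7 ≤ (k : ℝ) ^ 7 := by gcongr
    calc (d : ℝ) ≤ (2 : ℝ) ^ 7 * (k : ℝ) ^ 3 := by nlinarith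
      _ ≤ (k : ℝ) ^ 7 * (k : ℝ) ^ 3 := by gcongr
      _ = (k : ℝ) ^ 10 := by ring
  have hlogd : Real.log d ≤ 10 * Real.log k := by
    have := Real.log_le_log hd0 hdk
    rwa [Real.log_pow, Nat.cast_ofNat] at this
  have hmain : (d : ℝ) ^ (2 * k ^ 2) < (2 : ℝ) ^ (d - k) := by
    rw [← Real.log_lt_log_iff (by positivity) (by positivity), Real.log_pow, Real.log_pow,
      Nat.cast_sub hkd]
    push_cast
    have h1 : 2 * (k : ℝ) ^ 2 * Real.log d ≤ 20 * X := by
      have := mul_le_mul_of_nonneg_left hlogd (by positivity : 0 ≤ 2 * (k : ℝ) ^ 2)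
      linarith
    have h2 : 98 * X * 0.69 ≤ ((d : ℝ) - k) * Real.log 2 :=
      mul_le_mul (by linarith) hlog2.le (by norm_num) (by linarith)
    linarith
  exact_mod_cast hmain

/-- There are absolute constants `a` and `A` such that for every `k ≥ 2`
there exists `d ≤ a·k²·log k` with: for every `k`-Fourier-sparse signal `g`, every
`t ∈ ℝ`, and every `θ > 0`, `|g t|² ≤ A·k·∑_{j=1}^{d} |g (t + jθ)|²`. -/
theorem sparse_pointwise_shift_bound :
    ∃ a A : ℝ, 0 < a ∧ 0 < A ∧
      ∀ (k : ℕ), 2 ≤ k →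
        ∃ d : ℕ, (d : ℝ) ≤ a * (k : ℝ) ^ 2 * Real.log k ∧
          ∀ (v : ℕ → ℂ) (f : ℕ → ℝ) (g : ℝ → ℂ),
            (∀ x : ℝ, g x = ∑ j ∈ Finset.range k,
                v j * Complex.exp (2 * (Real.pi : ℂ) * Complex.I * (f j : ℂ) * (x : ℂ))) →
            ∀ (t θ : ℝ), 0 < θ →
              ‖g t‖ ^ 2 ≤ A * (k : ℝ) *
                ∑ j ∈ Finset.Icc 1 d, ‖g (t + (j : ℝ) * θ)‖ ^ 2 := by
  refine ⟨100, 1, by norm_num, one_pos, fun k hk => ?_⟩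
  obtain ⟨hkd, hd⟩ := floor_sq_mul_log_bounds hk
  refine ⟨⌊100 * (k : ℝ) ^ 2 * Real.log k⌋₊, Nat.floor_le (by positivity), ?_⟩
  intro v f g hg t θ _
  refine (norm_sq_le_sum_shifts hkd hd v f g hg t θ).trans ?_
  rw [one_mul]
  refine le_mul_of_one_le_left (by positivity) ?_
  exact_mod_cast (by omega : 1 ≤ k)
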